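/- arXiv:2206.12152 — 4 statements merged into one kernel-verified Lean document; each statement's English description precedes it below -/
import Mathlib

section
/- Let N and p be positive integers, X a real N×p matrix, β ∈ ℝ^p, e ∈ ℝ^N, and Y = X β + e. Let λ > 0 and let β̂ ∈ ℝ^p satisfy (1/N)‖Y − X β̂‖² + λ‖β̂‖₁ ≤ (1/N)‖Y − X b‖² + λ‖b‖₁ for every b ∈ ℝ^p. Let S = {j : β_j ≠ 0} and suppose (4/N)‖Xᵀ e‖_∞ ≤ λ. Then, writing δ = β̂ − β, it holds that (2/N)‖X δ‖² ≤ 3λ‖δ_S‖₁ − λ‖δ_{S^c}‖₁; in particular the cone condition ‖δ_{S^c}‖₁ ≤ 3‖δ_S‖₁ holds. -/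
open Matrix

/-- Squared Euclidean norm of a real vector. -/
noncomputable def sqnorm {n : ℕ} (v : Fin n → ℝ) : ℝ := ∑ i, (v i) ^ 2

/-- ℓ1-norm of a real vector. -/
noncomputable def l1norm {n : ℕ} (v : Fin n → ℝ) : ℝ := ∑ i, |v i|

/-- ℓ∞-norm of a real vector. -/
noncomputable def linfnorm {n : ℕ} (v : Fin n → ℝ) : ℝ := ⨆ i, |v i|

/-- ℓ1-norm of the subvector of `v` with indices in `I`. -/
noncomputable def l1on {n : ℕ} (I : Finset (Fin n)) (v : Fin n → ℝ) : ℝ := ∑ i ∈ I, |v i|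

theorem l1on_add_l1on_compl {n : ℕ} (I : Finset (Fin n)) (v : Fin n → ℝ) :
    l1on I v + l1on Iᶜ v = l1norm v :=
  Finset.sum_add_sum_compl I fun i => |v i|

theorem sqnorm_nonneg {n : ℕ} (v : Fin n → ℝ) : 0 ≤ sqnorm v :=
  Finset.sum_nonneg fun i _ => sq_nonneg (v i)

theorem sqnorm_sub {n : ℕ} (u v : Fin n → ℝ) :
    sqnorm (u - v) = sqnorm u - 2 * (u ⬝ᵥ v) + sqnorm v := by
  simp only [sqnorm, dotProduct, Finset.mul_sum, ← Finset.sum_sub_distrib,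
    ← Finset.sum_add_distrib, Pi.sub_apply]
  exact Finset.sum_congr rfl fun i _ => by ring

theorem abs_le_linfnorm {n : ℕ} (v : Fin n → ℝ) (i : Fin n) : |v i| ≤ linfnorm v :=
  le_ciSup (f := fun i => |v i|) (Set.finite_range _).bddAbove i

/-- Hölder's inequality for the pair `(ℓ∞, ℓ1)`. -/
theorem dotProduct_le_linfnorm_mul_l1norm {n : ℕ} (u v : Fin n → ℝ) :
    u ⬝ᵥ v ≤ linfnorm u * l1norm v := by
  rw [l1norm, Finset.mul_sum]
  refine Finset.sum_le_sum fun i _ => (le_abs_self _).trans ?_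
  rw [abs_mul]
  exact mul_le_mul_of_nonneg_right (abs_le_linfnorm u i) (abs_nonneg _)

/-- If `b` is supported in `I`, moving from `b` to `a` lowers the `ℓ1`-norm by at most the mass of
`a - b` on `I` minus its mass off `I`. -/
theorem l1norm_sub_l1norm_le {n : ℕ} (I : Finset (Fin n)) (a b : Fin n → ℝ)
    (hb : ∀ i ∉ I, b i = 0) :
    l1norm b - l1norm a ≤ l1on I (a - b) - l1on Iᶜ (a - b) := by
  have on_I : l1on I b - l1on I a ≤ l1on I (a - b) := by
    simp only [l1on, ← Finset.sum_sub_distrib]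
    refine Finset.sum_le_sum fun i _ => ?_
    rw [Pi.sub_apply, abs_sub_comm]
    exact abs_sub_abs_le_abs_sub (b i) (a i)
  have off_I : l1on Iᶜ b - l1on Iᶜ a = -l1on Iᶜ (a - b) := by
    simp only [l1on, ← Finset.sum_sub_distrib, ← Finset.sum_neg_distrib]
    refine Finset.sum_congr rfl fun i hi => ?_
    simp [hb i (Finset.mem_compl.mp hi)]
  linarith [l1on_add_l1on_compl I a, l1on_add_l1on_compl I b]

/-- Cone condition for the lasso error: if `β̂` is a lasso minimizer for `Y = X β + e`,
`S = {j : β_j ≠ 0}`, and `(4/N)‖Xᵀ e‖_∞ ≤ λ`, then with `δ = β̂ − β` one has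
`(2/N)‖X δ‖² ≤ 3λ‖δ_S‖₁ − λ‖δ_{Sᶜ}‖₁`, and in particular `‖δ_{Sᶜ}‖₁ ≤ 3‖δ_S‖₁`. -/
theorem lasso_cone_condition (N p : ℕ) (hN : 0 < N) (hp : 0 < p)
    (X : Matrix (Fin N) (Fin p) ℝ) (β : Fin p → ℝ) (e : Fin N → ℝ)
    (Y : Fin N → ℝ) (hY : Y = X.mulVec β + e)
    (lam : ℝ) (hlam : 0 < lam) (βh : Fin p → ℝ)
    (hmin : ∀ b : Fin p → ℝ,
      (1 / (N : ℝ)) * sqnorm (Y - X.mulVec βh) + lam * l1norm βh ≤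
        (1 / (N : ℝ)) * sqnorm (Y - X.mulVec b) + lam * l1norm b)
    (S : Finset (Fin p)) (hSdef : ∀ j, j ∈ S ↔ β j ≠ 0)
    (hpen : (4 / (N : ℝ)) * linfnorm (Xᵀ.mulVec e) ≤ lam) :
    (2 / (N : ℝ)) * sqnorm (X.mulVec (βh - β)) ≤
        3 * lam * l1on S (βh - β) - lam * l1on Sᶜ (βh - β) ∧
      l1on Sᶜ (βh - β) ≤ 3 * l1on S (βh - β) := by
  have basic := hmin β
  have hres : Y - X.mulVec βh = e - X.mulVec (βh - β) := by
    rw [hY, mulVec_sub]; abel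
  have hres' : Y - X.mulVec β = e := by rw [hY]; abel
  rw [hres, hres', sqnorm_sub] at basic
  have hdual : e ⬝ᵥ X.mulVec (βh - β) ≤ linfnorm (Xᵀ.mulVec e) * l1norm (βh - β) := by
    rw [dotProduct_mulVec, ← mulVec_transpose]
    exact dotProduct_le_linfnorm_mul_l1norm _ _
  have hl1 : 0 ≤ l1norm (βh - β) := Finset.sum_nonneg fun i _ => abs_nonneg _
  have hnoise : 4 / (N : ℝ) * (e ⬝ᵥ X.mulVec (βh - β)) ≤ lam * l1norm (βh - β) :=
    calc 4 / (N : ℝ) * (e ⬝ᵥ X.mulVec (βh - β))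
        ≤ 4 / (N : ℝ) * (linfnorm (Xᵀ.mulVec e) * l1norm (βh - β)) :=
          mul_le_mul_of_nonneg_left hdual (by positivity)
      _ = 4 / (N : ℝ) * linfnorm (Xᵀ.mulVec e) * l1norm (βh - β) := by ring
      _ ≤ lam * l1norm (βh - β) := mul_le_mul_of_nonneg_right hpen hl1
  have hpenalty := mul_le_mul_of_nonneg_left
    (l1norm_sub_l1norm_le S βh β fun j hj => by simpa [hSdef] using hj) hlam.le
  rw [← l1on_add_l1on_compl S] at hnoise
  have hbound : (2 / (N : ℝ)) * sqnorm (X.mulVec (βh - β)) ≤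
      3 * lam * l1on S (βh - β) - lam * l1on Sᶜ (βh - β) := by
    ring_nf at basic hnoise hpenalty ⊢
    linarith
  have hfit : 0 ≤ (2 / (N : ℝ)) * sqnorm (X.mulVec (βh - β)) :=
    mul_nonneg (by positivity) (sqnorm_nonneg _)
  exact ⟨hbound, le_of_mul_le_mul_left (by linarith) hlam⟩
end

section
/- Let N and p be positive integers, X a real N×p matrix, β ∈ ℝ^p, e ∈ ℝ^N, and Y = X β + e. Let λ > 0 and let β̂ ∈ ℝ^p satisfy (1/N)‖Y − X β̂‖² + λ‖β̂‖₁ ≤ (1/N)‖Y − X b‖² + λ‖b‖₁ for every b ∈ ℝ^p. Let S = {j : β_j ≠ 0} with s = |S|. Suppose that (4/N)‖Xᵀ e‖_∞ ≤ λ and that X fulfills the restricted eigenvalue condition RE(S, φ) for some constant φ > 0. Then (1/N)‖X(β̂ − β)‖² + λ‖β̂ − β‖₁ ≤ (4/φ²)·λ²·s; in particular ‖β̂ − β‖₁ ≤ (4/φ²)·λ·s. -/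
open Matrix

/-- A matrix `A ∈ ℝ^{N×p}` fulfills the restricted eigenvalue condition `RE(I, φ)` if
`‖b_I‖₁² ≤ (‖A b‖²/N)·(|I|/φ²)` for all `b` with `‖b_{Iᶜ}‖₁ ≤ 3‖b_I‖₁`. -/
def REcond {N p : ℕ} (A : Matrix (Fin N) (Fin p) ℝ) (I : Finset (Fin p)) (φ : ℝ) : Prop :=
  ∀ b : Fin p → ℝ, l1on Iᶜ b ≤ 3 * l1on I b →
    (l1on I b) ^ 2 ≤ (sqnorm (A.mulVec b) / N) * ((I.card : ℝ) / φ ^ 2)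

theorem l1norm_nonneg {n : ℕ} (v : Fin n → ℝ) : 0 ≤ l1norm v :=
  Finset.sum_nonneg fun i _ => abs_nonneg (v i)

/-- If `v` vanishes off `I`, then moving from `v` to `w` increases the ℓ1-norm by at least the
mass of `w - v` off `I` minus its mass on `I`. -/
theorem l1norm_add_l1on_compl_sub_le {n : ℕ} {I : Finset (Fin n)} {v : Fin n → ℝ}
    (hv : ∀ i ∉ I, v i = 0) (w : Fin n → ℝ) :
    l1norm v + l1on Iᶜ (w - v) ≤ l1norm w + l1on I (w - v) := by
  have on_I : l1on I v ≤ l1on I w + l1on I (w - v) := by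
    simp only [l1on, ← Finset.sum_add_distrib, Pi.sub_apply]
    refine Finset.sum_le_sum fun i _ => ?_
    have := abs_sub_abs_le_abs_sub (v i) (w i)
    rw [abs_sub_comm] at this
    linarith
  have off_v : l1on Iᶜ v = 0 :=
    Finset.sum_eq_zero fun i hi => by simp [hv i (Finset.mem_compl.mp hi)]
  have off_sub : l1on Iᶜ (w - v) = l1on Iᶜ w :=
    Finset.sum_congr rfl fun i hi => by simp [hv i (Finset.mem_compl.mp hi)]
  linarith [l1on_add_l1on_compl I v, l1on_add_l1on_compl I w]

/-- Deterministic lasso oracle inequality: if `β̂` is a lasso minimizer for `Y = X β + e`,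
`S = {j : β_j ≠ 0}` with `s = |S|`, `(4/N)‖Xᵀ e‖_∞ ≤ λ`, and `X` fulfills `RE(S, φ)`, then
`(1/N)‖X(β̂ − β)‖² + λ‖β̂ − β‖₁ ≤ (4/φ²)λ²s`; in particular `‖β̂ − β‖₁ ≤ (4/φ²)λs`. -/
theorem lasso_oracle_inequality (N p : ℕ) (hN : 0 < N) (hp : 0 < p)
    (X : Matrix (Fin N) (Fin p) ℝ) (β : Fin p → ℝ) (e : Fin N → ℝ)
    (Y : Fin N → ℝ) (hY : Y = X.mulVec β + e)
    (lam : ℝ) (hlam : 0 < lam) (βh : Fin p → ℝ)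
    (hmin : ∀ b : Fin p → ℝ,
      (1 / (N : ℝ)) * sqnorm (Y - X.mulVec βh) + lam * l1norm βh ≤
        (1 / (N : ℝ)) * sqnorm (Y - X.mulVec b) + lam * l1norm b)
    (S : Finset (Fin p)) (hSdef : ∀ j, j ∈ S ↔ β j ≠ 0) (s : ℕ) (hs : S.card = s)
    (hpen : (4 / (N : ℝ)) * linfnorm (Xᵀ.mulVec e) ≤ lam)
    (φ : ℝ) (hφ : 0 < φ) (hRE : REcond X S φ) :
    (1 / (N : ℝ)) * sqnorm (X.mulVec (βh - β)) + lam * l1norm (βh - β) ≤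
        (4 / φ ^ 2) * lam ^ 2 * s ∧
      l1norm (βh - β) ≤ (4 / φ ^ 2) * lam * s := by
  have hN' : (0 : ℝ) < N := Nat.cast_pos.mpr hN
  set δ := βh - β with hδ
  have hres : Y - X *ᵥ βh = e - X *ᵥ δ := by
    rw [hY, hδ, mulVec_sub]; abel
  have basic := hmin β
  rw [hres, show Y - X *ᵥ β = e by rw [hY]; abel, sqnorm_sub] at basic
  have noise : 2 * (1 / (N : ℝ)) * (e ⬝ᵥ X *ᵥ δ) ≤ lam / 2 * l1norm δ := by
    have holder : e ⬝ᵥ X *ᵥ δ ≤ linfnorm (Xᵀ *ᵥ e) * l1norm δ := by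
      rw [dotProduct_mulVec, ← mulVec_transpose]
      exact dotProduct_le_linfnorm_mul_l1norm _ _
    calc 2 * (1 / (N : ℝ)) * (e ⬝ᵥ X *ᵥ δ)
        ≤ 2 * (1 / (N : ℝ)) * (linfnorm (Xᵀ *ᵥ e) * l1norm δ) := by gcongr
      _ = (4 / (N : ℝ) * linfnorm (Xᵀ *ᵥ e)) / 2 * l1norm δ := by ring
      _ ≤ lam / 2 * l1norm δ :=
        mul_le_mul_of_nonneg_right (by linarith) (l1norm_nonneg δ)
  have support : l1norm β + l1on Sᶜ δ ≤ l1norm βh + l1on S δ :=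
    l1norm_add_l1on_compl_sub_le (fun j hj => not_not.mp fun h => hj ((hSdef j).mpr h)) βh
  have split := l1on_add_l1on_compl S δ
  have Q_nonneg : 0 ≤ 1 / (N : ℝ) * sqnorm (X *ᵥ δ) :=
    mul_nonneg (by positivity) (sqnorm_nonneg _)
  have hRE_S := hRE δ
  rw [div_eq_mul_one_div, mul_comm (sqnorm _), hs] at hRE_S
  set Q := 1 / (N : ℝ) * sqnorm (X *ᵥ δ)
  have pred : 2 * Q + lam * l1on Sᶜ δ ≤ 3 * (lam * l1on S δ) := by
    have := mul_le_mul_of_nonneg_left support hlam.le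
    rw [← split] at noise
    linarith
  have cone : l1on Sᶜ δ ≤ 3 * l1on S δ := by
    refine le_of_mul_le_mul_left ?_ hlam
    linarith
  have re := hRE_S cone
  have young : 4 * lam * l1on S δ ≤ Q + 4 / φ ^ 2 * lam ^ 2 * s := by
    refine le_of_abs_le (abs_le_of_sq_le_sq ?_ (by positivity))
    calc (4 * lam * l1on S δ) ^ 2 = 16 * lam ^ 2 * l1on S δ ^ 2 := by ring
      _ ≤ 16 * lam ^ 2 * (Q * (s / φ ^ 2)) := by gcongr
      _ = 4 * Q * (4 / φ ^ 2 * lam ^ 2 * s) := by ring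
      _ ≤ (Q + 4 / φ ^ 2 * lam ^ 2 * s) ^ 2 := four_mul_le_sq_add _ _
  have oracle : Q + lam * l1norm δ ≤ 4 / φ ^ 2 * lam ^ 2 * s := by
    rw [← split]
    linarith
  refine ⟨oracle, le_of_mul_le_mul_left ?_ hlam⟩
  calc lam * l1norm δ ≤ 4 / φ ^ 2 * lam ^ 2 * s := by linarith
    _ = lam * (4 / φ ^ 2 * lam * s) := by ring
end

section
/- Let N, p and s be positive integers and φ > 0 a constant. Let A be a real N×p matrix that fulfills the restricted eigenvalue condition RE(I, φ) for every index set I ⊆ {1,…,p} with |I| ≤ 2s. If β, β′ ∈ ℝ^p each have at most s nonzero components and A β = A β′, then β = β′. -/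
open Matrix

/-- If `A` fulfills the restricted eigenvalue condition `RE(I, φ)` for every index set `I`
with `|I| ≤ 2s`, then `s`-sparse vectors are identified: any two vectors with at most `s`
nonzero components and the same image under `A` coincide. -/
theorem sparse_identification (N p s : ℕ) (hN : 0 < N) (hp : 0 < p) (hs : 0 < s)
    (φ : ℝ) (hφ : 0 < φ)
    (A : Matrix (Fin N) (Fin p) ℝ)
    (hRE : ∀ I : Finset (Fin p), I.card ≤ 2 * s → REcond A I φ)
    (β β' : Fin p → ℝ)
    (hβ : {j | β j ≠ 0}.ncard ≤ s) (hβ' : {j | β' j ≠ 0}.ncard ≤ s)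
    (hAβ : A.mulVec β = A.mulVec β') : β = β' := by
  let S : Finset (Fin p) := {j | β j ≠ 0}
  let S' : Finset (Fin p) := {j | β' j ≠ 0}
  have hS : S.card ≤ s := by
    rw [← Set.ncard_coe_finset]
    simpa [S] using hβ
  have hS' : S'.card ≤ s := by
    rw [← Set.ncard_coe_finset]
    simpa [S'] using hβ'
  have hcard : (S ∪ S').card ≤ 2 * s := (Finset.card_union_le S S').trans (by lia)
  have hoff : ∀ j ∉ S ∪ S', (β - β') j = 0 := by
    intro j hj
    have hzero : β j = 0 ∧ β' j = 0 := by simpa [S, S'] using hj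
    simp [hzero.1, hzero.2]
  have hcompl : l1on (S ∪ S')ᶜ (β - β') = 0 :=
    Finset.sum_eq_zero fun j hj => by rw [hoff j (Finset.mem_compl.mp hj), abs_zero]
  have hnonneg : 0 ≤ l1on (S ∪ S') (β - β') := Finset.sum_nonneg fun j _ => abs_nonneg _
  have hbound := hRE _ hcard (β - β') (by rw [hcompl]; positivity)
  have himage : A.mulVec (β - β') = 0 := by rw [Matrix.mulVec_sub, hAβ, sub_self]
  have hsq : sqnorm (A.mulVec (β - β')) = 0 := by simp [himage, sqnorm]
  rw [hsq, zero_div, zero_mul] at hbound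
  have hl1 : l1on (S ∪ S') (β - β') = 0 := pow_eq_zero_iff two_ne_zero |>.mp
    (le_antisymm hbound (sq_nonneg _))
  have hon := (Finset.sum_eq_zero_iff_of_nonneg fun j _ => abs_nonneg _).mp hl1
  funext j
  by_cases hj : j ∈ S ∪ S'
  · exact sub_eq_zero.mp (abs_eq_zero.mp (hon j hj))
  · exact sub_eq_zero.mp (hoff j hj)
end

section
/- Let N, p be positive integers, I ⊆ {1,…,p} a nonempty index set with |I| = m, and φ > 0 a constant. Let A and B be real N×p matrices such that B fulfills the restricted eigenvalue condition RE(I, φ) and such that (32·m/φ²)·max_{j,j′} |((Aᵀ A − Bᵀ B)/N)_{j j′}| ≤ 1. Then A fulfills the restricted eigenvalue condition RE(I, φ/√2). -/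
open Matrix

/-- The squared norm of `A b` is the quadratic form of the Gram matrix `Aᵀ A` at `b`. -/
lemma sqnorm_mulVec_eq_dotProduct {N p : ℕ} (A : Matrix (Fin N) (Fin p) ℝ) (b : Fin p → ℝ) :
    sqnorm (A *ᵥ b) = b ⬝ᵥ ((Aᵀ * A) *ᵥ b) := by
  rw [← mulVec_mulVec, dotProduct_mulVec, vecMul_transpose]
  simp only [sqnorm, dotProduct, sq]

/-- A quadratic form whose matrix has entries bounded by `M` is at most `M ‖b‖₁²`. -/
lemma abs_dotProduct_mulVec_le {n : Type*} [Fintype n] {D : Matrix n n ℝ} {M : ℝ}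
    (hD : ∀ j k, |D j k| ≤ M) (b : n → ℝ) :
    |b ⬝ᵥ (D *ᵥ b)| ≤ M * (∑ i, |b i|) ^ 2 := by
  calc |b ⬝ᵥ (D *ᵥ b)| = |∑ j, ∑ k, b j * (D j k * b k)| := by
        simp only [dotProduct, mulVec, Finset.mul_sum]
    _ ≤ ∑ j, ∑ k, |b j * (D j k * b k)| :=
        (Finset.abs_sum_le_sum_abs _ _).trans
          (Finset.sum_le_sum fun _ _ => Finset.abs_sum_le_sum_abs _ _)
    _ ≤ ∑ j, ∑ k, M * (|b j| * |b k|) := by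
        refine Finset.sum_le_sum fun j _ => Finset.sum_le_sum fun k _ => ?_
        rw [abs_mul, abs_mul, mul_left_comm]
        exact mul_le_mul_of_nonneg_right (hD j k) (by positivity)
    _ = M * (∑ i, |b i|) ^ 2 := by
        rw [sq, Finset.sum_mul_sum]
        simp only [Finset.mul_sum]

/-- A term of a finite doubly indexed family of reals is at most the iterated supremum. -/
lemma le_ciSup_ciSup_of_finite {ι κ : Type*} [Finite ι] [Finite κ] (f : ι → κ → ℝ)
    (j : ι) (k : κ) : f j k ≤ ⨆ j, ⨆ k, f j k :=
  (le_ciSup (Set.finite_range (f j)).bddAbove k).trans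
    (le_ciSup (f := fun j => ⨆ k, f j k) (Set.finite_range _).bddAbove j)

/-- Restricted eigenvalue transfer: if `B` fulfills `RE(I, φ)` and the entrywise difference
of the normalized Gram matrices satisfies `(32 m / φ²)·max_{j,j'} |((Aᵀ A − Bᵀ B)/N)_{j j'}| ≤ 1`
with `m = |I|`, then `A` fulfills `RE(I, φ/√2)`. -/
theorem restricted_eigenvalue_transfer (N p : ℕ) (hN : 0 < N) (hp : 0 < p)
    (I : Finset (Fin p)) (hI : I.Nonempty) (m : ℕ) (hm : I.card = m)
    (φ : ℝ) (hφ : 0 < φ)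
    (A B : Matrix (Fin N) (Fin p) ℝ)
    (hB : REcond B I φ)
    (hclose :
      32 * (m : ℝ) / φ ^ 2 *
          (⨆ j : Fin p, ⨆ j' : Fin p, |((Aᵀ * A - Bᵀ * B) j j') / (N : ℝ)|) ≤ 1) :
    REcond A I (φ / Real.sqrt 2) := by
  intro b hb
  have hRE := hB b hb
  set M := ⨆ j : Fin p, ⨆ j' : Fin p, |((Aᵀ * A - Bᵀ * B) j j') / (N : ℝ)|
  set x := l1on I b
  have hentry : ∀ j k, |((N : ℝ)⁻¹ • (Aᵀ * A - Bᵀ * B)) j k| ≤ M := fun j k => by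
    rw [Matrix.smul_apply, smul_eq_mul, inv_mul_eq_div]
    exact le_ciSup_ciSup_of_finite (fun j k => |((Aᵀ * A - Bᵀ * B) j k) / (N : ℝ)|) j k
  have hM : 0 ≤ M := (abs_nonneg _).trans (hentry ⟨0, hp⟩ ⟨0, hp⟩)
  have hl1 : ∑ i, |b i| ≤ 4 * x := by
    have hsplit : x + l1on Iᶜ b = ∑ i, |b i| := Finset.sum_add_sum_compl I _
    linarith
  have hgram : sqnorm (B *ᵥ b) / N - sqnorm (A *ᵥ b) / N ≤ 16 * M * x ^ 2 := by
    have hform : b ⬝ᵥ (((N : ℝ)⁻¹ • (Aᵀ * A - Bᵀ * B)) *ᵥ b)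
        = sqnorm (A *ᵥ b) / N - sqnorm (B *ᵥ b) / N := by
      rw [smul_mulVec, dotProduct_smul, sub_mulVec, dotProduct_sub,
        ← sqnorm_mulVec_eq_dotProduct, ← sqnorm_mulVec_eq_dotProduct, smul_eq_mul]
      ring
    have habs := abs_dotProduct_mulVec_le hentry b
    rw [hform, abs_sub_comm] at habs
    calc _ ≤ M * (∑ i, |b i|) ^ 2 := (le_abs_self _).trans habs
      _ ≤ M * (4 * x) ^ 2 := by gcongr
      _ = 16 * M * x ^ 2 := by ring
  rw [hm] at hRE ⊢
  have hscale := mul_le_mul_of_nonneg_right hgram (show 0 ≤ (m : ℝ) / φ ^ 2 by positivity)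
  have hhalf := mul_le_mul_of_nonneg_right hclose (sq_nonneg x)
  have hsqrt : (m : ℝ) / (φ / √2) ^ 2 = 2 * (m / φ ^ 2) := by
    rw [div_pow, Real.sq_sqrt zero_le_two]
    field_simp
  rw [hsqrt]
  rw [mul_div_assoc] at hhalf
  linarith
end
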